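/- Let 𝔏 be a finite-dimensional Leibniz algebra over a field K of characteristic zero with Levi decomposition 𝔏 = 𝔤 ⋉ rad(𝔏), where 𝔤 is a semisimple Lie subalgebra of 𝔏 decomposing as a direct sum 𝔤 = 𝔤_1 ⊕ ... ⊕ 𝔤_m of simple Lie ideals of 𝔤, and let n ≥ 2. Then in the Leibniz n-algebra U_n(𝔏): each 𝔤_i is closed under the n-ary bracket and, with the restricted bracket, U_n(𝔤_i) is a simple Leibniz n-algebra; the n-solvable radical of U_n(𝔏) equals rad(𝔏); and the underlying vector space decomposes as U_n(𝔏) = (𝔤_1 ⊕ ... ⊕ 𝔤_m) ⊕ Rad(U_n(𝔏)). -/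

import Mathlib

section Defs

variable {K L : Type*}

/-- Right-nested iterated bracket `[x₀,[x₁,[…,[xₙ₋₁,xₙ]…]]]` built from a binary bracket. -/
def nestedBracket (b : L → L → L) : {n : ℕ} → (Fin (n + 1) → L) → L
  | 0, x => x 0
  | _ + 1, x => b (x 0) (nestedBracket b fun i => x i.succ)

/-- The (right) Leibniz identity for a binary bracket. -/
def IsLeibniz [Add L] (b : L → L → L) : Prop :=
  ∀ x y z, b (b x y) z = b (b x z) y + b x (b y z)

/-- The fundamental identity of a Leibniz `n`-algebra (arity `n + 1`). -/
def LeibnizNIdentity [AddCommMonoid L] {n : ℕ} (br : (Fin (n + 1) → L) → L) : Prop :=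
  ∀ (x : Fin (n + 1) → L) (y : Fin n → L),
    br (Fin.cons (br x) y) =
      ∑ i : Fin (n + 1), br (Function.update x i (br (Fin.cons (x i) y)))

variable [Field K] [AddCommGroup L] [Module K L]

/-- A subspace `I` is an ideal of a Leibniz `n`-algebra: it is an `s`-ideal for every
position `s`, i.e. `[z₁,…,zₙ] ∈ I` whenever some `z_s ∈ I`. -/
def IsNIdeal {n : ℕ} (br : (Fin (n + 1) → L) → L) (I : Submodule K L) : Prop :=
  ∀ (s : Fin (n + 1)) (z : Fin (n + 1) → L), z s ∈ I → br z ∈ I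

/-- The Leibniz `n`-kernel: the smallest ideal containing all brackets with a repeated entry. -/
def leibnizNKernel {n : ℕ} (br : (Fin (n + 1) → L) → L) : Submodule K L :=
  sInf {I : Submodule K L |
    IsNIdeal br I ∧ ∀ z : Fin (n + 1) → L, (∃ i j, i < j ∧ z i = z j) → br z ∈ I}

/-- A subspace `I` is a (two-sided) ideal of a Leibniz algebra. -/
def IsLeibnizIdeal (b : L →ₗ[K] L →ₗ[K] L) (I : Submodule K L) : Prop :=
  (∀ x ∈ I, ∀ y : L, b x y ∈ I) ∧ (∀ x ∈ I, ∀ y : L, b y x ∈ I)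

/-- The Leibniz kernel `span {[x,x] : x ∈ L}` of a Leibniz algebra. -/
def leibnizKernel (b : L →ₗ[K] L →ₗ[K] L) : Submodule K L :=
  Submodule.span K {v : L | ∃ x : L, b x x = v}

/-- The derived series of a subspace of a Leibniz algebra. -/
def derivedSeriesSub (b : L →ₗ[K] L →ₗ[K] L) (S : Submodule K L) : ℕ → Submodule K L
  | 0 => S
  | m + 1 => Submodule.span K
      {v : L | ∃ a ∈ derivedSeriesSub b S m, ∃ c ∈ derivedSeriesSub b S m, b a c = v}

/-- The `k`-derived series `H^{(m+1)_k}` of a subspace of a Leibniz `n`-algebra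
(indexed so that index `0` corresponds to `H^{(1)_k} = H`). -/
def kSeries {n : ℕ} (br : (Fin (n + 1) → L) → L) (k : ℕ) (H : Submodule K L) :
    ℕ → Submodule K L
  | 0 => H
  | p + 1 => Submodule.span K
      {v : L | ∃ z : Fin (n + 1) → L, ∃ s : Finset (Fin (n + 1)),
        k ≤ s.card ∧ (∀ i ∈ s, z i ∈ kSeries br k H p) ∧ br z = v}

end Defs

section Helpers

variable {K L : Type*} [Field K] [AddCommGroup L] [Module K L] (b : L →ₗ[K] L →ₗ[K] L)

theorem nestedBracket_mem {P : Submodule K L} (hP : ∀ x ∈ P, ∀ y ∈ P, b x y ∈ P) :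
    ∀ {n : ℕ} (z : Fin (n + 1) → L), (∀ j, z j ∈ P) → nestedBracket (fun a c => b a c) z ∈ P
  | 0, _, hz => hz 0
  | _ + 1, _, hz => hP _ (hz 0) _ (nestedBracket_mem hP _ fun j => hz j.succ)

theorem IsLeibnizIdeal.isNIdeal {I : Submodule K L} (hI : IsLeibnizIdeal b I) :
    ∀ {n : ℕ}, IsNIdeal (nestedBracket (n := n) fun a c => b a c) I
  | 0, s, z, hz => by
    obtain rfl : s = 0 := Fin.fin_one_eq_zero s
    exact hz
  | _ + 1, s, z, hz => by
    induction s using Fin.cases with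
    | zero => exact hI.1 _ hz _
    | succ s => exact hI.2 _ (isNIdeal hI s (fun i => z i.succ) hz) _

theorem IsLeibnizIdeal.nestedBracket_sub_mem {I : Submodule K L} (hI : IsLeibnizIdeal b I) :
    ∀ {n : ℕ} (z w : Fin (n + 1) → L), (∀ j, z j - w j ∈ I) →
      nestedBracket (fun a c => b a c) z - nestedBracket (fun a c => b a c) w ∈ I
  | 0, _, _, h => h 0
  | n + 1, z, w, h => by
    have ih := nestedBracket_sub_mem hI (fun j => z j.succ) (fun j => w j.succ) fun j => h j.succ
    have h₁ := hI.1 _ (h 0) (nestedBracket (fun a c => b a c) fun j => z j.succ)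
    have h₂ := hI.2 _ ih (w 0)
    convert I.add_mem h₁ h₂ using 1
    simp [nestedBracket]

/-- A perfect subspace is spanned by its nested brackets of any length. -/
theorem le_span_nestedBracket {P : Submodule K L}
    (hP : P ≤ Submodule.span K {v | ∃ a ∈ P, ∃ c ∈ P, b a c = v}) :
    ∀ n : ℕ, P ≤ Submodule.span K {v | ∃ z : Fin (n + 1) → L,
      (∀ j, z j ∈ P) ∧ nestedBracket (fun a c => b a c) z = v}
  | 0 => fun x hx => Submodule.subset_span ⟨fun _ => x, fun _ => hx, rfl⟩
  | n + 1 => by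
    refine hP.trans (Submodule.span_le.2 ?_)
    rintro _ ⟨a, ha, c, hc, rfl⟩
    have key : Submodule.span K {v | ∃ z : Fin (n + 1) → L,
        (∀ j, z j ∈ P) ∧ nestedBracket (fun a c => b a c) z = v} ≤
        (Submodule.span K {v | ∃ z : Fin (n + 1 + 1) → L,
          (∀ j, z j ∈ P) ∧ nestedBracket (fun a c => b a c) z = v}).comap (b a) := by
      refine Submodule.span_le.2 ?_
      rintro _ ⟨z, hz, rfl⟩
      refine Submodule.subset_span ⟨Fin.cons a z, fun j => ?_, by simp [nestedBracket]⟩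
      induction j using Fin.cases with
      | zero => exact ha
      | succ j => exact hz j
    exact key (le_span_nestedBracket hP n hc)

theorem bracket_mem_of_nestedBracket_mem {P I : Submodule K L}
    (hP : P ≤ Submodule.span K {v | ∃ a ∈ P, ∃ c ∈ P, b a c = v}) (n : ℕ) {x : L}
    (hx : ∀ z : Fin (n + 1) → L, (∀ j, z j ∈ P) →
      nestedBracket (n := n + 1) (fun a c => b a c) (Fin.cons x z) ∈ I)
    {y : L} (hy : y ∈ P) : b x y ∈ I := by
  have key : Submodule.span K {v | ∃ z : Fin (n + 1) → L,
      (∀ j, z j ∈ P) ∧ nestedBracket (fun a c => b a c) z = v} ≤ I.comap (b x) := by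
    refine Submodule.span_le.2 ?_
    rintro _ ⟨z, hz, rfl⟩
    simpa [nestedBracket] using hx z hz
  exact key (le_span_nestedBracket b hP n hy)

theorem derivedSeriesSub_bracket_mem {S : Submodule K L} (hS : ∀ x ∈ S, ∀ y ∈ S, b x y ∈ S) :
    ∀ p : ℕ, ∀ x ∈ derivedSeriesSub b S p, ∀ y ∈ derivedSeriesSub b S p,
      b x y ∈ derivedSeriesSub b S p
  | 0 => hS
  | p + 1 => by
    have hle : derivedSeriesSub b S (p + 1) ≤ derivedSeriesSub b S p := by
      refine Submodule.span_le.2 ?_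
      rintro _ ⟨a, ha, c, hc, rfl⟩
      exact derivedSeriesSub_bracket_mem hS p a ha c hc
    exact fun x hx y hy => Submodule.subset_span ⟨x, hle hx, y, hle hy, rfl⟩

theorem derivedSeriesSub_succ_le {S T : Submodule K L} (h : ∀ x ∈ S, ∀ y ∈ S, b x y ∈ T) :
    ∀ p : ℕ, derivedSeriesSub b S (p + 1) ≤ derivedSeriesSub b T p
  | 0 => by
    refine Submodule.span_le.2 ?_
    rintro _ ⟨a, ha, c, hc, rfl⟩
    exact h a ha c hc
  | p + 1 => by
    refine Submodule.span_mono ?_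
    rintro _ ⟨a, ha, c, hc, rfl⟩
    exact ⟨a, derivedSeriesSub_succ_le h p ha, c, derivedSeriesSub_succ_le h p hc, rfl⟩

theorem kSeries_le_derivedSeriesSub {S : Submodule K L} (hS : ∀ x ∈ S, ∀ y ∈ S, b x y ∈ S)
    (n : ℕ) : ∀ p : ℕ,
      kSeries (nestedBracket (n := n + 1) fun a c => b a c) (n + 1 + 1) S p ≤
        derivedSeriesSub b S p
  | 0 => le_rfl
  | p + 1 => by
    refine Submodule.span_mono ?_
    rintro _ ⟨z, s, hs, hz, rfl⟩
    obtain rfl : s = Finset.univ :=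
      Finset.eq_univ_of_card s (le_antisymm (Finset.card_le_univ s) (by simpa using hs))
    have hz' : ∀ j, z j ∈ derivedSeriesSub b S p := fun j =>
      kSeries_le_derivedSeriesSub hS n p (hz j (Finset.mem_univ j))
    exact ⟨z 0, hz' 0, _, nestedBracket_mem b (derivedSeriesSub_bracket_mem b hS p)
      (fun j => z j.succ) fun j => hz' j.succ, rfl⟩

/-- A perfect subspace contained in `H` modulo an ideal `R` stays, modulo `R`, in every term of
the series of `H`. -/
theorem le_kSeries_sup {P H R : Submodule K L} (hR : IsLeibnizIdeal b R)
    (hP : P ≤ Submodule.span K {v | ∃ a ∈ P, ∃ c ∈ P, b a c = v}) (hPH : P ≤ H ⊔ R) (n : ℕ) :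
    ∀ p : ℕ, P ≤ kSeries (nestedBracket (n := n) fun a c => b a c) (n + 1) H p ⊔ R
  | 0 => hPH
  | p + 1 => by
    refine (le_span_nestedBracket b hP n).trans (Submodule.span_le.2 ?_)
    rintro _ ⟨z, hz, rfl⟩
    choose w hw r hr hwr using fun j =>
      Submodule.mem_sup.1 (le_kSeries_sup hR hP hPH n p (hz j))
    refine Submodule.mem_sup.2 ⟨nestedBracket (fun a c => b a c) w,
      Submodule.subset_span ⟨w, Finset.univ, by simp, fun j _ => hw j, rfl⟩, _,
      hR.nestedBracket_sub_mem b z w fun j => ?_, by abel⟩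
    rw [← hwr j, add_sub_cancel_left]
    exact hr j

theorem perfect_of_simple {P : Submodule K L} (hP : ∀ x ∈ P, ∀ y ∈ P, b x y ∈ P)
    (hne : ∃ x ∈ P, ∃ y ∈ P, b x y ≠ 0)
    (hsimple : ∀ I : Submodule K L, I ≤ P →
      (∀ x ∈ I, ∀ y ∈ P, b x y ∈ I ∧ b y x ∈ I) → I = ⊥ ∨ I = P) :
    P ≤ Submodule.span K {v | ∃ a ∈ P, ∃ c ∈ P, b a c = v} := by
  have hle : Submodule.span K {v | ∃ a ∈ P, ∃ c ∈ P, b a c = v} ≤ P := by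
    refine Submodule.span_le.2 ?_
    rintro _ ⟨a, ha, c, hc, rfl⟩
    exact hP a ha c hc
  rcases hsimple _ hle fun x hx y hy =>
    ⟨Submodule.subset_span ⟨x, hle hx, y, hy, rfl⟩,
      Submodule.subset_span ⟨y, hy, x, hle hx, rfl⟩⟩ with h | h
  · obtain ⟨x, hx, y, hy, hxy⟩ := hne
    refine absurd ?_ hxy
    rw [← Submodule.mem_bot K, ← h]
    exact Submodule.subset_span ⟨x, hx, y, hy, rfl⟩
  · exact h.ge

theorem bracket_swap {G : Submodule K L} (hG : ∀ x ∈ G, b x x = 0) {x y : L} (hx : x ∈ G)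
    (hy : y ∈ G) : b y x = -b x y := by
  have h := hG _ (G.add_mem hx hy)
  simp only [map_add, LinearMap.add_apply, hG x hx, hG y hy, zero_add, add_zero] at h
  exact eq_neg_of_add_eq_zero_left h

/-- If `G` is a perfect Lie subalgebra complementing an ideal `R`, then adding `R` to an ideal
of the `n`-algebra of nested brackets yields an ideal of the Leibniz algebra. -/
theorem IsNIdeal.isLeibnizIdeal_sup {G R H : Submodule K L} (hR : IsLeibnizIdeal b R)
    (hG : ∀ x ∈ G, b x x = 0) (hGR : G ⊔ R = ⊤)
    (hperf : G ≤ Submodule.span K {v | ∃ a ∈ G, ∃ c ∈ G, b a c = v}) {n : ℕ}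
    (hH : IsNIdeal (nestedBracket (n := n + 1) fun a c => b a c) H) :
    IsLeibnizIdeal b (H ⊔ R) := by
  have hleft : ∀ x ∈ H ⊔ R, ∀ y ∈ G, b x y ∈ H ⊔ R := by
    intro x hx y hy
    obtain ⟨h, hh, r, hr, rfl⟩ := Submodule.mem_sup.1 hx
    rw [map_add, LinearMap.add_apply]
    exact Submodule.add_mem_sup
      (bracket_mem_of_nestedBracket_mem b hperf n (fun z _ => hH 0 _ hh) hy) (hR.1 r hr y)
  have hsplit : ∀ y : L, ∃ u ∈ G, ∃ r ∈ R, u + r = y := fun y =>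
    Submodule.mem_sup.1 (hGR ▸ Submodule.mem_top)
  have hRle : R ≤ H ⊔ R := le_sup_right
  constructor
  · intro x hx y
    obtain ⟨u, hu, r, hr, rfl⟩ := hsplit y
    rw [map_add]
    exact Submodule.add_mem _ (hleft x hx u hu) (hRle (hR.2 r hr x))
  · intro x hx y
    obtain ⟨u, hu, r, hr, rfl⟩ := hsplit y
    obtain ⟨v, hv, s, hs, rfl⟩ := hsplit x
    have hvJ : v ∈ H ⊔ R := by simpa using Submodule.sub_mem _ hx (hRle hs)
    rw [map_add b, LinearMap.add_apply, map_add (b u), bracket_swap b hG hv hu]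
    exact Submodule.add_mem _ (Submodule.add_mem _ (Submodule.neg_mem _ (hleft v hvJ u hu))
      (hRle (hR.2 s hs u))) (hRle (hR.1 r hr _))

end Helpers

/-- Levi decomposition in `U_n(𝔏)`. Let `𝔏 = 𝔤 ⋉ rad(𝔏)` be a Levi
decomposition of a finite-dimensional Leibniz algebra over a field of characteristic zero,
with `𝔤` a (semisimple) Lie subalgebra decomposing as a direct sum of simple Lie ideals
`𝔤 = 𝔤₁ ⊕ … ⊕ 𝔤ₘ`. Then in `U_n(𝔏)` (arity `n + 1`, `1 ≤ n`): each `𝔤ᵢ` is closed under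
the `n`-ary bracket and `U_n(𝔤ᵢ)` is a simple Leibniz `n`-algebra; the `n`-solvable radical
of `U_n(𝔏)` equals `rad(𝔏)`; and `U_n(𝔏) = (𝔤₁ ⊕ … ⊕ 𝔤ₘ) ⊕ Rad(U_n(𝔏))` as vector
spaces. -/
theorem stmt_19 {K L : Type*} [Field K] [CharZero K] [AddCommGroup L] [Module K L]
    [FiniteDimensional K L]
    (b : L →ₗ[K] L →ₗ[K] L) (hb : IsLeibniz fun x y => b x y)
    (n : ℕ) (hn : 1 ≤ n)
    -- the solvable radical `R = rad(𝔏)`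
    (R : Submodule K L) (hRid : IsLeibnizIdeal b R)
    (hRsolv : ∃ p, derivedSeriesSub b R p = ⊥)
    (hRmax : ∀ I : Submodule K L, IsLeibnizIdeal b I →
      (∃ p, derivedSeriesSub b I p = ⊥) → I ≤ R)
    -- the Levi subalgebra `𝔤`, a Lie subalgebra complementing the radical
    (G : Submodule K L) (hGsub : ∀ x ∈ G, ∀ y ∈ G, b x y ∈ G)
    (hGLie : ∀ x ∈ G, b x x = 0)
    (hLevi₁ : G ⊔ R = ⊤) (hLevi₂ : G ⊓ R = ⊥)
    -- the decomposition `𝔤 = 𝔤₁ ⊕ … ⊕ 𝔤ₘ` into simple Lie ideals of `𝔤`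
    (m : ℕ) (g : Fin m → Submodule K L)
    (hgle : ∀ i, g i ≤ G)
    (hgsup : (⨆ i, g i) = G)
    (hgindep : ∀ i, Disjoint (g i) (⨆ j ∈ ({i}ᶜ : Set (Fin m)), g j))
    (hgideal : ∀ i, ∀ x ∈ g i, ∀ y ∈ G, b x y ∈ g i ∧ b y x ∈ g i)
    (hgsimple : ∀ i,
      (∃ x ∈ g i, ∃ y ∈ g i, b x y ≠ 0) ∧
        ∀ I : Submodule K L, I ≤ g i →
          (∀ x ∈ I, ∀ y ∈ g i, b x y ∈ I ∧ b y x ∈ I) → I = ⊥ ∨ I = g i) :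
    -- each `𝔤ᵢ` is closed under the `n`-ary bracket of `U_n(𝔏)`
    (∀ i, ∀ x : Fin (n + 1) → L, (∀ j, x j ∈ g i) →
        nestedBracket (fun a c => b a c) x ∈ g i) ∧
      -- with the restricted bracket, each `U_n(𝔤ᵢ)` is a simple Leibniz `n`-algebra
      (∀ i,
        (∃ x : Fin (n + 1) → L, (∀ j, x j ∈ g i) ∧
            nestedBracket (fun a c => b a c) x ≠ 0) ∧
          ∀ I : Submodule K L, I ≤ g i →
            (∀ (s : Fin (n + 1)) (z : Fin (n + 1) → L), (∀ j, z j ∈ g i) → z s ∈ I →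
              nestedBracket (fun a c => b a c) z ∈ I) → I = ⊥ ∨ I = g i) ∧
      -- the `n`-solvable radical of `U_n(𝔏)` is `rad(𝔏)`
      ((IsNIdeal (nestedBracket (n := n) fun a c => b a c) R ∧
          ∃ p, kSeries (nestedBracket (n := n) fun a c => b a c) (n + 1) R p = ⊥) ∧
        ∀ H : Submodule K L, IsNIdeal (nestedBracket (n := n) fun a c => b a c) H →
          (∃ p, kSeries (nestedBracket (n := n) fun a c => b a c) (n + 1) H p = ⊥) →
            H ≤ R) ∧
      -- the vector-space decomposition `U_n(𝔏) = (𝔤₁ ⊕ … ⊕ 𝔤ₘ) ⊕ Rad(U_n(𝔏))`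
      ((⨆ i, g i) ⊔ R = ⊤ ∧ (⨆ i, g i) ⊓ R = ⊥) := by
  obtain ⟨n, rfl⟩ : ∃ k, n = k + 1 := ⟨n - 1, by omega⟩
  have hgsub : ∀ i, ∀ x ∈ g i, ∀ y ∈ g i, b x y ∈ g i := fun i x hx y hy =>
    (hgideal i x hx y (hgle i hy)).1
  have hperf : ∀ i, g i ≤ Submodule.span K {v | ∃ a ∈ g i, ∃ c ∈ g i, b a c = v} := fun i =>
    perfect_of_simple b (hgsub i) (hgsimple i).1 (hgsimple i).2
  have hGperf : G ≤ Submodule.span K {v | ∃ a ∈ G, ∃ c ∈ G, b a c = v} := by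
    conv_lhs => rw [← hgsup]
    refine iSup_le fun i => (hperf i).trans (Submodule.span_mono ?_)
    rintro _ ⟨a, ha, c, hc, rfl⟩
    exact ⟨a, hgle i ha, c, hgle i hc, rfl⟩
  have hgne : ∀ i, g i ≠ ⊥ := by
    intro i h
    obtain ⟨x, hx, y, -, hxy⟩ := (hgsimple i).1
    rw [h, Submodule.mem_bot] at hx
    simp [hx] at hxy
  refine ⟨fun i x hx => nestedBracket_mem b (hgsub i) x hx, fun i => ⟨?_, fun I hI hIn => ?_⟩,
    ⟨⟨hRid.isNIdeal b, ?_⟩, fun H hH hHsolv => ?_⟩, hgsup ▸ hLevi₁, hgsup ▸ hLevi₂⟩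
  · by_contra! hzero
    refine hgne i (eq_bot_iff.2 ((le_span_nestedBracket b (hperf i) (n + 1)).trans
      (Submodule.span_le.2 ?_)))
    rintro _ ⟨z, hz, rfl⟩
    exact hzero z hz
  · refine (hgsimple i).2 I hI fun x hx y hy => ?_
    have hxy : b x y ∈ I := bracket_mem_of_nestedBracket_mem b (hperf i) n
      (fun z hz => hIn 0 _ (fun j => by
        induction j using Fin.cases with
        | zero => exact hI hx
        | succ j => exact hz j) hx) hy
    refine ⟨hxy, ?_⟩
    rw [bracket_swap b hGLie (hgle i (hI hx)) (hgle i hy)]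
    exact I.neg_mem hxy
  · obtain ⟨p, hp⟩ := hRsolv
    exact ⟨p, eq_bot_iff.2 (hp ▸ kSeries_le_derivedSeriesSub b
      (fun x hx y _ => hRid.1 x hx y) n p)⟩
  · have hJ : IsLeibnizIdeal b (H ⊔ R) := hH.isLeibnizIdeal_sup b hRid hGLie hLevi₁ hGperf
    have hinf : ∀ i, (H ⊔ R) ⊓ g i = ⊥ := by
      intro i
      refine ((hgsimple i).2 _ inf_le_right fun x hx y hy =>
        ⟨⟨hJ.1 x hx.1 y, hgsub i x hx.2 y hy⟩,
          ⟨hJ.2 x hx.1 y, hgsub i y hy x hx.2⟩⟩).resolve_right fun h => ?_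
      obtain ⟨p, hp⟩ := hHsolv
      have hle := le_kSeries_sup b hRid (hperf i) (inf_eq_right.1 h) (n + 1) p
      rw [hp, bot_sup_eq] at hle
      exact hgne i (eq_bot_iff.2 (hLevi₂ ▸ le_inf (hgle i) hle))
    have hcentral : ∀ x ∈ H ⊔ R, x ∈ G → ∀ y ∈ G, b x y = 0 := by
      intro x hx hxG y hy
      have hle : G ≤ LinearMap.ker (b x) := by
        rw [← hgsup]
        refine iSup_le fun i y hy => ?_
        rw [LinearMap.mem_ker, ← Submodule.mem_bot K, ← hinf i]
        exact ⟨hJ.1 x hx y, (hgideal i y hy x hxG).2⟩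
      exact hle hy
    have hbr : ∀ x ∈ H ⊔ R, ∀ y ∈ H ⊔ R, b x y ∈ R := by
      intro x hx y _
      obtain ⟨u, hu, r, hr, rfl⟩ := Submodule.mem_sup.1 (hLevi₁ ▸ Submodule.mem_top : x ∈ G ⊔ R)
      obtain ⟨v, hv, s, hs, rfl⟩ := Submodule.mem_sup.1 (hLevi₁ ▸ Submodule.mem_top : y ∈ G ⊔ R)
      have huJ : u ∈ H ⊔ R := by
        simpa using Submodule.sub_mem _ hx ((le_sup_right : R ≤ H ⊔ R) hr)
      rw [map_add b, LinearMap.add_apply, map_add (b u), hcentral u huJ hu v hv, zero_add]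
      exact R.add_mem (hRid.2 s hs u) (hRid.1 r hr _)
    obtain ⟨p, hp⟩ := hRsolv
    exact le_sup_left.trans (hRmax _ hJ
      ⟨p + 1, eq_bot_iff.2 (hp ▸ derivedSeriesSub_succ_le b hbr p)⟩)
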